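/- Let γ be a 1-admissible datum for G, so V^γ is a faithful representation of Ǧ. Then the weights of V^γ generate the full coweight lattice Λ, and for every i ∈ I one has ⟨γ, ω̌ᵢ⟩ > 0 (for the fundamental weights ω̌ᵢ). Moreover, for each maximal positive root α̌ one has ⟨γ, α̌⟩ = 1. -/

import Mathlib

open scoped BigOperators

namespace AutSheaf

/-- Coweight/weight lattice realized as `ℤⁿ`. -/
abbrev Lat (n : ℕ) := Fin n → ℤ

/-- The canonical perfect pairing between the coweight lattice and the weight lattice. -/
def pair {n : ℕ} (l w : Lat n) : ℤ := ∑ i, l i * w i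

lemma pair_sub_smul {n : ℕ} (a b w : Lat n) (k : ℤ) :
    pair (a - k • b) w = pair a w - k * pair b w := by
  simp [pair, sub_mul, Finset.sum_sub_distrib, Finset.mul_sum, mul_assoc]

/-- Combinatorial (root) datum of a connected reductive group: both the coweight
lattice `Λ` and the weight lattice `Λ̌` are realized as `ℤⁿ`, paired by `pair`;
`roots` is the (finite) set of roots (living on the weight side), `coroot α` is the
coroot of the root `α` (living on the coweight side), and `simple` enumerates the
simple roots of the chosen Borel. -/
structure RootDatum (n m : ℕ) where
  roots : Finset (Lat n)
  coroot : Lat n → Lat n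
  simple : Fin m → Lat n
  simple_mem : ∀ i, simple i ∈ roots
  simple_inj : Function.Injective simple
  root_ne_zero : ∀ α ∈ roots, α ≠ (0 : Lat n)
  neg_mem : ∀ α ∈ roots, -α ∈ roots
  coroot_neg : ∀ α ∈ roots, coroot (-α) = -coroot α
  pair_coroot_self : ∀ α ∈ roots, pair (coroot α) α = 2
  root_comb : ∀ α ∈ roots,
      (∃ c : Fin m → ℕ, α = ∑ i, (c i : ℤ) • simple i) ∨
      (∃ c : Fin m → ℕ, α = -∑ i, (c i : ℤ) • simple i)
  reflect_mem : ∀ α ∈ roots, ∀ β ∈ roots, β - pair (coroot α) β • α ∈ roots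

namespace RootDatum

variable {n m : ℕ} (R : RootDatum n m)

/-- The set of positive roots. -/
noncomputable def posRoots : Finset (Lat n) :=
  @Finset.filter _ (fun α => ∃ c : Fin m → ℕ, α = ∑ i, (c i : ℤ) • R.simple i)
    (Classical.decPred _) R.roots

/-- A coweight is dominant if it pairs nonnegatively with every simple root. -/
def IsDominant (v : Lat n) : Prop := ∀ i, 0 ≤ pair v (R.simple i)

/-- `v` is a `ℤ₊`-combination of positive coroots. -/
def PosCorootComb (v : Lat n) : Prop :=
  ∃ c : Lat n → ℕ, v = ∑ α ∈ R.posRoots, (c α : ℤ) • R.coroot α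

/-- The order on coweights: `a ≤ b` iff `b - a` is a `ℤ₊`-combination of positive
coroots. -/
def cole (a b : Lat n) : Prop := R.PosCorootComb (b - a)

/-- A dominant coweight is minuscule if it is a minimal nonzero element of the set of
dominant coweights for the order `cole`. -/
def Minuscule (g : Lat n) : Prop :=
  R.IsDominant g ∧ g ≠ 0 ∧
    ∀ v : Lat n, R.IsDominant v → v ≠ 0 → R.cole v g → v = g

/-- The coroot lattice. -/
def corootSpan : Submodule ℤ (Lat n) := Submodule.span ℤ (R.coroot '' ↑R.roots)

/-- The root lattice (inside the weight lattice). -/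
def rootSpan : Submodule ℤ (Lat n) := Submodule.span ℤ (↑R.roots : Set (Lat n))

/-- `π₁(G) = Λ / (coroot lattice)`. -/
abbrev Pi1 := Lat n ⧸ R.corootSpan

/-- The projection `Λ → π₁(G)`. -/
def toPi1 (v : Lat n) : R.Pi1 := Submodule.Quotient.mk v

/-- The simple reflection on the coweight lattice, as a function. -/
def sreflFun (i : Fin m) (v : Lat n) : Lat n :=
  v - pair v (R.simple i) • R.coroot (R.simple i)

lemma sreflFun_invol (i : Fin m) (v : Lat n) : R.sreflFun i (R.sreflFun i v) = v := by
  have h2 : pair (R.coroot (R.simple i)) (R.simple i) = 2 :=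
    R.pair_coroot_self _ (R.simple_mem i)
  have hp : pair (R.sreflFun i v) (R.simple i) = -pair v (R.simple i) := by
    rw [sreflFun, pair_sub_smul, h2]; ring
  rw [sreflFun, hp]
  unfold sreflFun
  module

/-- The simple reflection on the coweight lattice. -/
def srefl (i : Fin m) : Equiv.Perm (Lat n) :=
  ⟨R.sreflFun i, R.sreflFun i, R.sreflFun_invol i, R.sreflFun_invol i⟩

/-- The Weyl group, acting on the coweight lattice. -/
def weyl : Subgroup (Equiv.Perm (Lat n)) := Subgroup.closure (Set.range R.srefl)

/-- The Weyl orbit of a coweight. -/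
def orbit (g : Lat n) : Set (Lat n) := {v | ∃ w ∈ R.weyl, w g = v}

/-- `V^γ` is a faithful representation of the dual group `Ǧ` iff its set of weights
(which, for minuscule `γ`, is the Weyl orbit of `γ`) generates the full lattice `Λ`. -/
def FaithfulHW (g : Lat n) : Prop := Submodule.span ℤ (R.orbit g) = ⊤

/-- `{γ}` is a 1-admissible datum: the center `Z(G)` is a 1-dimensional connected
torus (i.e. `Λ̌/(root lattice) ≅ ℤ`), `π₁(G) ≅ ℤ`, `γ` is a minuscule dominant coweight
whose image generates `π₁(G)`, and `V^γ` is faithful. -/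
def IsOneAdmissible (g : Lat n) : Prop :=
  Nonempty ((Lat n ⧸ R.rootSpan) ≃ₗ[ℤ] ℤ) ∧
  Nonempty (R.Pi1 ≃ₗ[ℤ] ℤ) ∧
  R.Minuscule g ∧
  (∀ x : R.Pi1, ∃ k : ℤ, x = k • R.toPi1 g) ∧
  R.FaithfulHW g

/-- `Λ⁺_{G,S} = { μ ∈ Λ⁺ : μ ≤ kγ for some k ≥ 0 }`. -/
def LamGS (g : Lat n) : Set (Lat n) :=
  {v | R.IsDominant v ∧ ∃ k : ℕ, R.cole v (k • g)}

/-- A weight is dominant if it pairs nonnegatively with every simple coroot. -/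
def IsDominantWeight (lc : Lat n) : Prop := ∀ i, 0 ≤ pair (R.coroot (R.simple i)) lc

/-- `Λ̌⁺_S = { λ̌ ∈ Λ̌⁺ : ⟨w₀(λ), λ̌⟩ ≥ 0 for all λ ∈ Λ⁺_{G,S} }`. -/
def LamCheckS (g : Lat n) (w0 : Equiv.Perm (Lat n)) : Set (Lat n) :=
  {lc | R.IsDominantWeight lc ∧ ∀ v ∈ R.LamGS g, 0 ≤ pair (w0 v) lc}

section Levi

variable (IM : Set (Fin m))

/-- A coweight is `M`-dominant for the standard Levi `M` attached to `IM ⊂ I` if it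
pairs nonnegatively with the simple roots from `IM`. -/
def IsMDominant (v : Lat n) : Prop := ∀ i ∈ IM, 0 ≤ pair v (R.simple i)

/-- The positive roots of the standard Levi `M`. -/
noncomputable def posRootsM : Finset (Lat n) :=
  @Finset.filter _ (fun α => α ∈ Submodule.span ℤ (R.simple '' IM))
    (Classical.decPred _) R.posRoots

/-- `v` is a `ℤ₊`-combination of positive coroots of `M`. -/
def PosCorootCombM (v : Lat n) : Prop :=
  ∃ c : Lat n → ℕ, v = ∑ α ∈ R.posRootsM IM, (c α : ℤ) • R.coroot α

/-- The order on coweights generated by the positive coroots of `M`. -/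
def coleM (a b : Lat n) : Prop := R.PosCorootCombM IM (b - a)

/-- Minuscule dominant coweight for the Levi `M`. -/
def MinusculeM (g : Lat n) : Prop :=
  R.IsMDominant IM g ∧ g ≠ 0 ∧
    ∀ v : Lat n, R.IsMDominant IM v → v ≠ 0 → R.coleM IM v g → v = g

/-- `Λ⁺_{M,S} = { λ ∈ Λ⁺_M : wλ ∈ Λ⁺_{G,S} for some w ∈ W }`. -/
def LamMS (g : Lat n) : Set (Lat n) :=
  {v | R.IsMDominant IM v ∧ ∃ w ∈ R.weyl, w v ∈ R.LamGS g}

/-- `π₁(M) = Λ_{G,P}`: the quotient of `Λ` by the span of the simple coroots from `IM`. -/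
abbrev Pi1M := Lat n ⧸ Submodule.span ℤ ((fun i => R.coroot (R.simple i)) '' IM)

/-- The projection `Λ → π₁(M)`. -/
def toPi1M (v : Lat n) : R.Pi1M IM := Submodule.Quotient.mk v

/-- `Λ^{+,θ}_{M,S}`: elements of `Λ⁺_{M,S}` whose image in `π₁(G)` is `θ`
(the image of `γ`). -/
def LamThetaMS (g : Lat n) : Set (Lat n) :=
  {v | v ∈ R.LamMS IM g ∧ R.toPi1 v = R.toPi1 g}

end Levi

end RootDatum

end AutSheaf

namespace AutSheaf

section Pairing

variable {n : ℕ}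

lemma pair_add_left (a b w : Lat n) : pair (a + b) w = pair a w + pair b w :=
  add_dotProduct a b w

lemma pair_sub_left (a b w : Lat n) : pair (a - b) w = pair a w - pair b w :=
  sub_dotProduct a b w

lemma pair_neg_left (a w : Lat n) : pair (-a) w = -pair a w := neg_dotProduct a w

lemma pair_smul_left (k : ℤ) (a w : Lat n) : pair (k • a) w = k * pair a w :=
  smul_dotProduct k a w

lemma pair_zero_left (w : Lat n) : pair 0 w = 0 := zero_dotProduct w

lemma pair_sum_left {ι : Type*} (s : Finset ι) (f : ι → Lat n) (w : Lat n) :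
    pair (∑ i ∈ s, f i) w = ∑ i ∈ s, pair (f i) w := sum_dotProduct s f w

lemma pair_sub_right (a v w : Lat n) : pair a (v - w) = pair a v - pair a w :=
  dotProduct_sub a v w

lemma pair_smul_right (k : ℤ) (a w : Lat n) : pair a (k • w) = k * pair a w :=
  dotProduct_smul k a w

lemma pair_zero_right (a : Lat n) : pair a 0 = 0 := dotProduct_zero a

lemma pair_sum_right {ι : Type*} (s : Finset ι) (a : Lat n) (f : ι → Lat n) :
    pair a (∑ i ∈ s, f i) = ∑ i ∈ s, pair a (f i) := dotProduct_sum a s f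

lemma eq_of_pair_left_eq {a b : Lat n} (h : ∀ w, pair a w = pair b w) : a = b :=
  dotProduct_eq a b h

lemma exists_eq_pair_left (f : Lat n →ₗ[ℤ] ℤ) : ∃ a : Lat n, ∀ w, f w = pair a w := by
  refine ⟨fun i => f (Pi.single i 1), fun w => ?_⟩
  rw [LinearMap.pi_apply_eq_sum_univ f w]
  refine Finset.sum_congr rfl fun i _ => ?_
  rw [smul_eq_mul, mul_comm]
  congr 3
  ext j
  simp [Pi.single_apply, eq_comm]

lemma pair_comm (a b : Lat n) : pair a b = pair b a := dotProduct_comm a b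

lemma pair_eq_zero_of_mem_span {S : Set (Lat n)} {w : Lat n} (h : ∀ v ∈ S, pair v w = 0)
    {v : Lat n} (hv : v ∈ Submodule.span ℤ S) : pair v w = 0 := by
  induction hv using Submodule.span_induction with
  | mem x hx => exact h x hx
  | zero => exact pair_zero_left w
  | add x y _ _ hx hy => rw [pair_add_left, hx, hy, add_zero]
  | smul k x _ hx => rw [pair_smul_left, hx, mul_zero]

end Pairing

namespace RootDatum

variable {n m : ℕ} (R : RootDatum n m)

/-- The reflection in a root, acting on the weight lattice. -/
def weightRefl (β x : Lat n) : Lat n := x - pair (R.coroot β) x • β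

/-- The reflection in a root, acting on the coweight lattice. -/
def coweightRefl (β v : Lat n) : Lat n := v - pair v β • R.coroot β

lemma pair_coweightRefl (β v x : Lat n) :
    pair (R.coweightRefl β v) x = pair v (R.weightRefl β x) := by
  simp only [coweightRefl, weightRefl, pair_sub_left, pair_sub_right, pair_smul_left,
    pair_smul_right]
  ring

lemma weightRefl_weightRefl {β : Lat n} (hβ : β ∈ R.roots) (x : Lat n) :
    R.weightRefl β (R.weightRefl β x) = x := by
  have h : pair (R.coroot β) (R.weightRefl β x) = -pair (R.coroot β) x := by
    rw [weightRefl, pair_sub_right, pair_smul_right, R.pair_coroot_self β hβ]; ring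
  rw [weightRefl, h, weightRefl]
  module

/-- The map from coweights to weights given by the Weyl-invariant form
`(u, v) ↦ ∑_δ ⟨u, δ⟩ ⟨v, δ⟩`. -/
def formMap : Lat n →ₗ[ℤ] Lat n where
  toFun u := ∑ δ ∈ R.roots, pair u δ • δ
  map_add' u v := by simp only [pair_add_left, add_smul, Finset.sum_add_distrib]
  map_smul' k v := by
    simp only [pair_smul_left, mul_smul, Finset.smul_sum, RingHom.id_apply]

lemma formMap_apply (u : Lat n) : R.formMap u = ∑ δ ∈ R.roots, pair u δ • δ := rfl

lemma pair_formMap (u v : Lat n) :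
    pair u (R.formMap v) = ∑ δ ∈ R.roots, pair u δ * pair v δ := by
  rw [formMap_apply, pair_sum_right]
  exact Finset.sum_congr rfl fun δ _ => by rw [pair_smul_right, mul_comm]

lemma pair_root_eq_zero_of_form {u : Lat n} (h : pair u (R.formMap u) = 0) :
    ∀ δ ∈ R.roots, pair u δ = 0 := by
  rw [pair_formMap, Finset.sum_eq_zero_iff_of_nonneg fun δ _ => mul_self_nonneg _] at h
  exact fun δ hδ => mul_self_eq_zero.1 (h δ hδ)

lemma formMap_eq_zero_of_pair_root {u : Lat n} (h : ∀ δ ∈ R.roots, pair u δ = 0) :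
    R.formMap u = 0 := by
  rw [formMap_apply]
  exact Finset.sum_eq_zero fun δ hδ => by rw [h δ hδ, zero_smul]

lemma formMap_coweightRefl {β : Lat n} (hβ : β ∈ R.roots) (u : Lat n) :
    R.formMap (R.coweightRefl β u) = R.weightRefl β (R.formMap u) := by
  have hr : R.weightRefl β (R.formMap u) =
      ∑ δ ∈ R.roots, pair u δ • R.weightRefl β δ := by
    simp only [weightRefl, formMap_apply, pair_sum_right, pair_smul_right, smul_sub,
      Finset.sum_sub_distrib, Finset.sum_smul, mul_smul]
  rw [hr, formMap_apply]
  refine Finset.sum_nbij' (R.weightRefl β) (R.weightRefl β)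
    (R.reflect_mem β hβ) (R.reflect_mem β hβ)
    (fun δ _ => R.weightRefl_weightRefl hβ δ) (fun δ _ => R.weightRefl_weightRefl hβ δ)
    fun δ _ => ?_
  rw [pair_coweightRefl, R.weightRefl_weightRefl hβ]

/-- The squared length of a coroot for the Weyl-invariant form. -/
def corootNorm (β : Lat n) : ℤ := pair (R.coroot β) (R.formMap (R.coroot β))

lemma corootNorm_pos {β : Lat n} (hβ : β ∈ R.roots) : 0 < R.corootNorm β := by
  refine lt_of_le_of_ne ?_ fun h => ?_
  · rw [corootNorm, pair_formMap]
    exact Finset.sum_nonneg fun δ _ => mul_self_nonneg _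
  · have := R.pair_root_eq_zero_of_form h.symm β hβ
    rw [R.pair_coroot_self β hβ] at this
    norm_num at this

lemma two_smul_formMap_coroot {β : Lat n} (hβ : β ∈ R.roots) :
    (2 : ℤ) • R.formMap (R.coroot β) = R.corootNorm β • β := by
  have h := R.formMap_coweightRefl hβ (R.coroot β)
  have h1 : R.coweightRefl β (R.coroot β) = -R.coroot β := by
    rw [coweightRefl, R.pair_coroot_self β hβ]; module
  rw [h1, map_neg, weightRefl] at h
  change _ = _ - R.corootNorm β • β at h
  rw [two_smul]
  linear_combination -h

lemma coroot_mem_corootSpan {β : Lat n} (hβ : β ∈ R.roots) : R.coroot β ∈ R.corootSpan :=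
  Submodule.subset_span ⟨β, hβ, rfl⟩

lemma exists_formMap_eq_smul {y : Lat n} (hy : y ∈ R.rootSpan) :
    ∃ k : ℤ, k ≠ 0 ∧ ∃ x ∈ R.corootSpan, R.formMap x = k • y := by
  induction hy using Submodule.span_induction with
  | mem β hβ =>
    exact ⟨R.corootNorm β, (R.corootNorm_pos hβ).ne', (2 : ℤ) • R.coroot β,
      Submodule.smul_mem _ _ (R.coroot_mem_corootSpan hβ), by
        rw [map_smul, R.two_smul_formMap_coroot hβ]⟩
  | zero => exact ⟨1, one_ne_zero, 0, zero_mem _, by simp⟩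
  | add y z _ _ hy hz =>
    obtain ⟨k, hk, u, hu, hku⟩ := hy
    obtain ⟨l, hl, v, hv, hlv⟩ := hz
    refine ⟨k * l, mul_ne_zero hk hl, l • u + k • v,
      add_mem (Submodule.smul_mem _ _ hu) (Submodule.smul_mem _ _ hv), ?_⟩
    rw [map_add, map_smul, map_smul, hku, hlv]
    module
  | smul a y _ hy =>
    obtain ⟨k, hk, u, hu, hku⟩ := hy
    refine ⟨k, hk, a • u, Submodule.smul_mem _ _ hu, ?_⟩
    rw [map_smul, hku, smul_comm]

/-- The Weyl-invariant form is nondegenerate on the coroot lattice. -/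
def FormNondegenerate : Prop := ∀ u ∈ R.corootSpan, R.formMap u = 0 → u = 0

/-- If the center and `π₁` both have rank one, the invariant form is nondegenerate on the
coroot lattice. -/
lemma formNondegenerate
    (hc : Nonempty ((Lat n ⧸ R.rootSpan) ≃ₗ[ℤ] ℤ)) (hp : Nonempty (R.Pi1 ≃ₗ[ℤ] ℤ)) :
    R.FormNondegenerate := by
  intro u hu h0
  obtain ⟨e⟩ := hc
  obtain ⟨e'⟩ := hp
  let g : Lat n →ₗ[ℤ] ℤ := e.toLinearMap ∘ₗ R.rootSpan.mkQ
  let f : Lat n →ₗ[ℤ] ℤ := e'.toLinearMap ∘ₗ R.corootSpan.mkQ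
  have hg : ∀ x, g x = 0 ↔ x ∈ R.rootSpan := fun x => by simp [g]
  have hf : ∀ x, f x = 0 ↔ x ∈ R.corootSpan := fun x => by simp [f]
  have hgs : Function.Surjective g := e.surjective.comp R.rootSpan.mkQ_surjective
  have hfs : Function.Surjective f := e'.surjective.comp R.corootSpan.mkQ_surjective
  obtain ⟨a, ha⟩ := exists_eq_pair_left g
  obtain ⟨b, hb⟩ := exists_eq_pair_left f
  obtain ⟨x₁, hx₁⟩ := hgs 1
  have huroot : ∀ δ ∈ R.roots, pair u δ = 0 :=
    R.pair_root_eq_zero_of_form (by rw [h0, pair_zero_right])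
  have hua : u = pair u x₁ • a := by
    refine eq_of_pair_left_eq fun w => ?_
    have hmem : w - g w • x₁ ∈ R.rootSpan := by
      rw [← hg, map_sub, map_smul, hx₁, smul_eq_mul, mul_one, sub_self]
    have : pair (w - g w • x₁) u = 0 :=
      pair_eq_zero_of_mem_span (fun δ hδ => by rw [pair_comm]; exact huroot δ hδ) hmem
    rw [pair_comm, pair_sub_right, pair_smul_right, sub_eq_zero] at this
    rw [this, pair_smul_left, ha, mul_comm]
  have hfu : pair u x₁ * f a = 0 := by
    rw [← smul_eq_mul, ← map_smul, ← hua]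
    exact (hf u).2 hu
  rcases mul_eq_zero.1 hfu with h | h
  · rw [hua, h, zero_smul]
  · exfalso
    have hb_root : b ∈ R.rootSpan := by
      rw [← hg, ha, pair_comm, ← hb, h]
    obtain ⟨k, hk, x, hx, hxb⟩ := R.exists_formMap_eq_smul hb_root
    have hxx : pair x (R.formMap x) = 0 := by
      rw [hxb, pair_smul_right, pair_comm, ← hb, (hf x).2 hx, mul_zero]
    rw [R.formMap_eq_zero_of_pair_root (R.pair_root_eq_zero_of_form hxx)] at hxb
    have hb0 : b = 0 := (smul_eq_zero.1 hxb.symm).resolve_left hk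
    obtain ⟨y, hy⟩ := hfs 1
    rw [hb, hb0, pair_zero_left] at hy
    exact zero_ne_one hy

lemma mem_posRoots {β : Lat n} :
    β ∈ R.posRoots ↔ β ∈ R.roots ∧ ∃ c : Fin m → ℕ, β = ∑ i, (c i : ℤ) • R.simple i :=
  @Finset.mem_filter _ _ (Classical.decPred _) _ _

lemma mem_roots_of_mem_posRoots {β : Lat n} (h : β ∈ R.posRoots) : β ∈ R.roots :=
  (R.mem_posRoots.1 h).1

lemma simple_mem_posRoots (i : Fin m) : R.simple i ∈ R.posRoots :=
  R.mem_posRoots.2 ⟨R.simple_mem i, Pi.single i 1, by simp [Pi.single_apply]⟩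

lemma neg_mem_posRoots_of_notMem {β : Lat n} (hβ : β ∈ R.roots) (h : β ∉ R.posRoots) :
    -β ∈ R.posRoots := by
  rcases R.root_comb β hβ with hc | ⟨c, hc⟩
  · exact absurd (R.mem_posRoots.2 ⟨hβ, hc⟩) h
  · exact R.mem_posRoots.2 ⟨R.neg_mem β hβ, c, by rw [hc, neg_neg]⟩

section PosCorootComb

lemma posCorootComb_zero : R.PosCorootComb 0 := ⟨0, by simp⟩

variable {R}

lemma PosCorootComb.add {u v : Lat n} (hu : R.PosCorootComb u) (hv : R.PosCorootComb v) :
    R.PosCorootComb (u + v) := by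
  obtain ⟨c, rfl⟩ := hu
  obtain ⟨d, rfl⟩ := hv
  exact ⟨c + d, by simp [add_smul, Finset.sum_add_distrib]⟩

lemma posCorootComb_smul_coroot {β : Lat n} (hβ : β ∈ R.posRoots) {k : ℤ} (hk : 0 ≤ k) :
    R.PosCorootComb (k • R.coroot β) := by
  classical
  refine ⟨Pi.single β k.toNat, ?_⟩
  rw [Finset.sum_eq_single β]
  · simp [hk]
  · intro δ _ hδ
    simp [hδ]
  · exact fun h => absurd hβ h

lemma PosCorootComb.mem_corootSpan {u : Lat n} (hu : R.PosCorootComb u) :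
    u ∈ R.corootSpan := by
  obtain ⟨c, rfl⟩ := hu
  exact sum_mem fun δ hδ => Submodule.smul_mem _ _
    (R.coroot_mem_corootSpan (R.mem_roots_of_mem_posRoots hδ))

lemma PosCorootComb.pair_nonneg {u w : Lat n} (hu : R.PosCorootComb u)
    (hw : ∀ β ∈ R.posRoots, 0 ≤ pair (R.coroot β) w) : 0 ≤ pair u w := by
  obtain ⟨c, rfl⟩ := hu
  rw [pair_sum_left]
  refine Finset.sum_nonneg fun δ hδ => ?_
  rw [pair_smul_left]
  exact mul_nonneg (Int.natCast_nonneg _) (hw δ hδ)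

end PosCorootComb

/-- The word `l` in the simple reflections, acting on the coweight lattice. -/
def coweightWord (l : List (Fin m)) (v : Lat n) : Lat n :=
  l.foldr (fun i u => R.coweightRefl (R.simple i) u) v

/-- The word `l` in the simple reflections, acting on the weight lattice. -/
def weightWord (l : List (Fin m)) (x : Lat n) : Lat n :=
  l.foldr (fun i u => R.weightRefl (R.simple i) u) x

lemma coweightWord_cons (i : Fin m) (l : List (Fin m)) (v : Lat n) :
    R.coweightWord (i :: l) v = R.coweightRefl (R.simple i) (R.coweightWord l v) := rfl

lemma weightWord_cons (i : Fin m) (l : List (Fin m)) (x : Lat n) :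
    R.weightWord (i :: l) x = R.weightRefl (R.simple i) (R.weightWord l x) := rfl

lemma coweightWord_append (l l' : List (Fin m)) (v : Lat n) :
    R.coweightWord (l ++ l') v = R.coweightWord l (R.coweightWord l' v) :=
  List.foldr_append

lemma coweightRefl_coweightRefl (i : Fin m) (v : Lat n) :
    R.coweightRefl (R.simple i) (R.coweightRefl (R.simple i) v) = v :=
  R.sreflFun_invol i v

lemma coweightWord_sub_smul (l : List (Fin m)) (u v : Lat n) (k : ℤ) :
    R.coweightWord l (u - k • v) = R.coweightWord l u - k • R.coweightWord l v := by
  induction l with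
  | nil => rfl
  | cons i l ih =>
    simp only [coweightWord_cons, ih, coweightRefl, pair_sub_left, pair_smul_left]
    module

lemma coweightWord_zero (l : List (Fin m)) : R.coweightWord l 0 = 0 := by
  simpa using R.coweightWord_sub_smul l 0 0 1

lemma coweightWord_neg (l : List (Fin m)) (v : Lat n) :
    R.coweightWord l (-v) = -R.coweightWord l v := by
  simpa [R.coweightWord_zero] using R.coweightWord_sub_smul l 0 v 1

lemma coweightWord_reverse (l : List (Fin m)) (v : Lat n) :
    R.coweightWord l.reverse (R.coweightWord l v) = v := by
  induction l with
  | nil => rfl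
  | cons i l ih =>
    rw [List.reverse_cons, coweightWord_append]
    change R.coweightWord l.reverse
      (R.coweightRefl _ (R.coweightRefl _ (R.coweightWord l v))) = v
    rw [coweightRefl_coweightRefl, ih]

lemma weightWord_mem (l : List (Fin m)) {β : Lat n} (hβ : β ∈ R.roots) :
    R.weightWord l β ∈ R.roots := by
  induction l with
  | nil => exact hβ
  | cons i l ih => exact R.reflect_mem _ (R.simple_mem i) _ ih

lemma pair_coweightWord_weightWord (l : List (Fin m)) (v x : Lat n) :
    pair (R.coweightWord l v) (R.weightWord l x) = pair v x := by
  induction l with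
  | nil => rfl
  | cons i l ih =>
    rw [coweightWord_cons, weightWord_cons, pair_coweightRefl,
      R.weightRefl_weightRefl (R.simple_mem i), ih]

lemma exists_coweightWord_eq {w : Equiv.Perm (Lat n)} (hw : w ∈ R.weyl) :
    ∃ l, ∀ v, w v = R.coweightWord l v := by
  induction hw using Subgroup.closure_induction with
  | mem s hs =>
    obtain ⟨i, rfl⟩ := hs
    exact ⟨[i], fun v => rfl⟩
  | one => exact ⟨[], fun v => rfl⟩
  | mul s t _ _ hs ht =>
    obtain ⟨k, hk⟩ := hs
    obtain ⟨l, hl⟩ := ht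
    exact ⟨k ++ l, fun v => by rw [coweightWord_append, Equiv.Perm.mul_apply, hl, hk]⟩
  | inv s _ hs =>
    obtain ⟨k, hk⟩ := hs
    refine ⟨k.reverse, fun v => ?_⟩
    rw [Equiv.Perm.inv_eq_iff_eq, hk]
    simpa using (R.coweightWord_reverse k.reverse v).symm

section Nondegenerate

variable {R}

lemma FormNondegenerate.coroot_weightRefl (hnd : R.FormNondegenerate) {β δ : Lat n}
    (hβ : β ∈ R.roots) (hδ : δ ∈ R.roots) :
    R.coroot (R.weightRefl β δ) = R.coweightRefl β (R.coroot δ) := by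
  have hβδ : R.weightRefl β δ ∈ R.roots := R.reflect_mem β hβ δ hδ
  set ε := R.weightRefl β δ with hε
  have hu := R.two_smul_formMap_coroot hβδ
  have hu' : (2 : ℤ) • R.formMap (R.coweightRefl β (R.coroot δ)) = R.corootNorm δ • ε := by
    rw [R.formMap_coweightRefl hβ]
    have h := R.two_smul_formMap_coroot hδ
    have : (2 : ℤ) • R.weightRefl β (R.formMap (R.coroot δ)) =
        R.weightRefl β ((2 : ℤ) • R.formMap (R.coroot δ)) := by
      simp only [weightRefl, pair_smul_right]; module
    rw [this, h, hε]
    simp only [weightRefl, pair_smul_right]; module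
  have hmem : R.coweightRefl β (R.coroot δ) ∈ R.corootSpan :=
    sub_mem (R.coroot_mem_corootSpan hδ)
      (Submodule.smul_mem _ _ (R.coroot_mem_corootSpan hβ))
  have key : R.corootNorm δ • R.coroot ε = R.corootNorm ε • R.coweightRefl β (R.coroot δ) := by
    rw [← sub_eq_zero]
    refine hnd _ (sub_mem (Submodule.smul_mem _ _ (R.coroot_mem_corootSpan hβδ))
      (Submodule.smul_mem _ _ hmem)) ?_
    have h2 : (2 : ℤ) • R.formMap (R.corootNorm δ • R.coroot ε -
        R.corootNorm ε • R.coweightRefl β (R.coroot δ)) = 0 := by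
      rw [map_sub, map_smul, map_smul, smul_sub, smul_comm, hu, smul_comm (2 : ℤ), hu',
        smul_comm, sub_self]
    exact (smul_eq_zero.1 h2).resolve_left two_ne_zero
  have hp : pair (R.coweightRefl β (R.coroot δ)) ε = 2 := by
    rw [pair_coweightRefl, hε, R.weightRefl_weightRefl hβ, R.pair_coroot_self δ hδ]
  have hN := congrArg (fun v => pair v ε) key
  simp only [pair_smul_left, hp, R.pair_coroot_self ε hβδ] at hN
  have hN' : R.corootNorm δ = R.corootNorm ε := mul_right_cancel₀ two_ne_zero hN
  rw [hN'] at key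
  exact smul_right_injective _ (R.corootNorm_pos hβδ).ne' key

lemma FormNondegenerate.coroot_weightWord (hnd : R.FormNondegenerate) (l : List (Fin m))
    {β : Lat n} (hβ : β ∈ R.roots) :
    R.coroot (R.weightWord l β) = R.coweightWord l (R.coroot β) := by
  induction l with
  | nil => rfl
  | cons i l ih =>
    rw [weightWord_cons, hnd.coroot_weightRefl (R.simple_mem i) (R.weightWord_mem l hβ), ih,
      coweightWord_cons]

lemma FormNondegenerate.coweightWord_coweightRefl (hnd : R.FormNondegenerate)
    (l : List (Fin m)) {β : Lat n} (hβ : β ∈ R.roots) (v : Lat n) :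
    R.coweightWord l (R.coweightRefl β v) =
      R.coweightRefl (R.weightWord l β) (R.coweightWord l v) := by
  rw [coweightRefl, coweightWord_sub_smul, ← hnd.coroot_weightWord l hβ, coweightRefl,
    pair_coweightWord_weightWord]

variable {ω : Fin m → Lat n}

/-- The coordinates of `2Φ(u)` in the simple roots are those of `u` in the simple coroots,
up to the norms of the simple coroots. -/
lemma FormNondegenerate.pair_fundamental_mul_corootNorm (hnd : R.FormNondegenerate)
    (hω : ∀ i j, pair (R.coroot (R.simple j)) (ω i) = if i = j then 1 else 0)
    {u : Lat n} (hu : u ∈ R.corootSpan) {c : Fin m → ℤ}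
    (hc : (2 : ℤ) • R.formMap u = ∑ j, c j • R.simple j) (i : Fin m) :
    pair u (ω i) * R.corootNorm (R.simple i) = c i := by
  set N : Fin m → ℤ := fun j => R.corootNorm (R.simple j) with hN
  set P : ℤ := ∏ j, N j with hP
  let Q : Fin m → ℤ := fun j => ∏ k ∈ Finset.univ.erase j, N k
  have hQ : ∀ j, Q j * N j = P := fun j => Finset.prod_erase_mul _ _ (Finset.mem_univ j)
  have hP0 : P ≠ 0 := Finset.prod_ne_zero_iff.2
    fun j _ => (R.corootNorm_pos (R.simple_mem j)).ne'
  have hx : P • u - ∑ j, (c j * Q j) • R.coroot (R.simple j) = 0 := by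
    refine hnd _ (sub_mem (Submodule.smul_mem _ _ hu) (sum_mem fun j _ =>
      Submodule.smul_mem _ _ (R.coroot_mem_corootSpan (R.simple_mem j)))) ?_
    refine (smul_eq_zero.1 (?_ : (2 : ℤ) • R.formMap _ = 0)).resolve_left two_ne_zero
    rw [map_sub, map_sum, smul_sub, map_smul, smul_comm, hc, Finset.smul_sum, Finset.smul_sum,
      sub_eq_zero]
    refine Finset.sum_congr rfl fun j _ => ?_
    rw [map_smul, smul_comm (2 : ℤ), R.two_smul_formMap_coroot (R.simple_mem j), smul_smul,
      smul_smul, ← hQ j]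
    congr 1
    simp only [hN]
    ring
  have hpair := congrArg (fun v => pair v (ω i)) (sub_eq_zero.1 hx)
  simp only [pair_smul_left, pair_sum_left, hω, mul_ite, mul_one, mul_zero,
    Finset.sum_ite_eq, Finset.mem_univ, if_true] at hpair
  refine mul_left_cancel₀ hP0 ?_
  change P * (pair u (ω i) * N i) = P * c i
  rw [← mul_assoc, hpair, mul_assoc, hQ, mul_comm]

lemma FormNondegenerate.simple_coeff_eq_zero (hnd : R.FormNondegenerate)
    (hω : ∀ i j, pair (R.coroot (R.simple j)) (ω i) = if i = j then 1 else 0)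
    {c : Fin m → ℤ} (hc : ∑ j, c j • R.simple j = 0) (i : Fin m) : c i = 0 := by
  rw [← hnd.pair_fundamental_mul_corootNorm hω (zero_mem _) (c := c)
    (by rw [map_zero, smul_zero, hc]) i, pair_zero_left, zero_mul]

lemma FormNondegenerate.pair_coroot_fundamental (hnd : R.FormNondegenerate)
    (hω : ∀ i j, pair (R.coroot (R.simple j)) (ω i) = if i = j then 1 else 0)
    {β : Lat n} (hβ : β ∈ R.roots) {c : Fin m → ℤ} (hc : β = ∑ j, c j • R.simple j)
    (i : Fin m) :
    pair (R.coroot β) (ω i) * R.corootNorm (R.simple i) = R.corootNorm β * c i :=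
  hnd.pair_fundamental_mul_corootNorm hω (R.coroot_mem_corootSpan hβ)
    (c := fun j => R.corootNorm β * c j)
    ((R.two_smul_formMap_coroot hβ).trans ((congrArg (R.corootNorm β • ·) hc).trans
      (by simp only [Finset.smul_sum, mul_smul]))) i

lemma FormNondegenerate.pair_coroot_fundamental_nonneg (hnd : R.FormNondegenerate)
    (hω : ∀ i j, pair (R.coroot (R.simple j)) (ω i) = if i = j then 1 else 0)
    {β : Lat n} (hβ : β ∈ R.posRoots) (i : Fin m) : 0 ≤ pair (R.coroot β) (ω i) := by
  obtain ⟨hr, c, hc⟩ := R.mem_posRoots.1 hβ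
  have h := hnd.pair_coroot_fundamental hω hr hc i
  have h1 := R.corootNorm_pos (R.simple_mem i)
  have h2 := R.corootNorm_pos hr
  exact nonneg_of_mul_nonneg_left (h ▸ by positivity) h1

lemma FormNondegenerate.pair_coroot_sum_fundamental_pos (hnd : R.FormNondegenerate)
    (hω : ∀ i j, pair (R.coroot (R.simple j)) (ω i) = if i = j then 1 else 0)
    {β : Lat n} (hβ : β ∈ R.posRoots) : 0 < pair (R.coroot β) (∑ i, ω i) := by
  rw [pair_sum_right]
  have hnn := fun i (_ : i ∈ Finset.univ) => hnd.pair_coroot_fundamental_nonneg hω hβ i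
  refine lt_of_le_of_ne (Finset.sum_nonneg hnn) fun h => ?_
  rw [eq_comm, Finset.sum_eq_zero_iff_of_nonneg hnn] at h
  obtain ⟨hr, c, hc⟩ := R.mem_posRoots.1 hβ
  refine R.root_ne_zero β hr ?_
  rw [hc]
  refine Finset.sum_eq_zero fun i _ => ?_
  have hi := hnd.pair_coroot_fundamental hω hr hc i
  rw [h i (Finset.mem_univ i), zero_mul, eq_comm, mul_eq_zero] at hi
  rw [hi.resolve_left (R.corootNorm_pos hr).ne', zero_smul]

/-- A simple reflection makes no positive root negative except its own simple root. -/
lemma FormNondegenerate.eq_simple_of_weightRefl_notMem (hnd : R.FormNondegenerate)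
    (hω : ∀ i j, pair (R.coroot (R.simple j)) (ω i) = if i = j then 1 else 0)
    {β : Lat n} (hβ : β ∈ R.posRoots) {j : Fin m}
    (h : R.weightRefl (R.simple j) β ∉ R.posRoots) : β = R.simple j := by
  obtain ⟨hr, b, hb⟩ := R.mem_posRoots.1 hβ
  obtain ⟨-, d, hd⟩ := R.mem_posRoots.1
    (R.neg_mem_posRoots_of_notMem (R.reflect_mem _ (R.simple_mem j) β hr) h)
  have hsum : ∑ k, ((b k : ℤ) + d k -
      if k = j then pair (R.coroot (R.simple j)) β else 0) • R.simple k = 0 := by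
    simp only [sub_smul, add_smul, Finset.sum_sub_distrib, Finset.sum_add_distrib, ite_smul,
      zero_smul, Finset.sum_ite_eq', Finset.mem_univ, if_true]
    rw [← hb, ← hd]
    module
  have hb0 : ∀ k, k ≠ j → (b k : ℤ) = 0 := by
    intro k hk
    have := hnd.simple_coeff_eq_zero hω hsum k
    rw [if_neg hk] at this
    omega
  have hbj : β = (b j : ℤ) • R.simple j := by
    rw [hb, Finset.sum_eq_single j]
    · exact fun k _ hk => by rw [hb0 k hk, zero_smul]
    · exact fun hj => absurd (Finset.mem_univ j) hj
  set k := pair (R.coroot β) (ω j) with hk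
  have hkN := hnd.pair_coroot_fundamental hω hr hb j
  have hcor : R.coroot β = k • R.coroot (R.simple j) := by
    rw [← sub_eq_zero]
    refine hnd _ (sub_mem (R.coroot_mem_corootSpan hr)
      (Submodule.smul_mem _ _ (R.coroot_mem_corootSpan (R.simple_mem j)))) ?_
    refine (smul_eq_zero.1 (?_ : (2 : ℤ) • R.formMap _ = 0)).resolve_left two_ne_zero
    rw [map_sub, map_smul, smul_sub, smul_comm, R.two_smul_formMap_coroot hr,
      R.two_smul_formMap_coroot (R.simple_mem j), smul_smul, hkN, mul_smul, ← hbj, sub_self]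
  have h2 := R.pair_coroot_self β hr
  rw [hcor, hbj, pair_smul_left, pair_smul_right, R.pair_coroot_self _ (R.simple_mem j)] at h2
  have h1 : (b j : ℤ) * k = 1 := by linarith
  have hb1 : (b j : ℤ) = 1 := Int.eq_one_of_mul_eq_one_right (Int.natCast_nonneg _) h1
  rw [hbj, hb1, one_smul]

/-- The deletion condition for words in the simple reflections. -/
lemma FormNondegenerate.exists_word_length_le (hnd : R.FormNondegenerate)
    (hω : ∀ i j, pair (R.coroot (R.simple j)) (ω i) = if i = j then 1 else 0)
    (l : List (Fin m)) (i : Fin m) (h : R.weightWord l (R.simple i) ∉ R.posRoots) :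
    ∃ l' : List (Fin m), l'.length ≤ l.length ∧
      ∀ v, R.coweightWord l (R.coweightRefl (R.simple i) v) = R.coweightWord l' v := by
  induction l with
  | nil => exact absurd (R.simple_mem_posRoots i) h
  | cons j l ih =>
    by_cases hl : R.weightWord l (R.simple i) ∈ R.posRoots
    · have hj := hnd.eq_simple_of_weightRefl_notMem hω hl h
      refine ⟨l, by simp, fun v => ?_⟩
      rw [coweightWord_cons, hnd.coweightWord_coweightRefl l (R.simple_mem i), hj,
        coweightRefl_coweightRefl]
    · obtain ⟨l', hlen, hl'⟩ := ih hl
      exact ⟨j :: l', by simpa using hlen, fun v => by simp only [coweightWord_cons, hl']⟩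

/-- A dominant coweight dominates its Weyl orbit. -/
lemma FormNondegenerate.posCorootComb_sub_coweightWord (hnd : R.FormNondegenerate)
    (hω : ∀ i j, pair (R.coroot (R.simple j)) (ω i) = if i = j then 1 else 0)
    {g : Lat n} (hg : R.IsDominant g) (l : List (Fin m)) :
    R.PosCorootComb (g - R.coweightWord l g) := by
  induction hk : l.length using Nat.strong_induction_on generalizing l with
  | _ k ih =>
    subst hk
    rcases List.eq_nil_or_concat l with rfl | ⟨l, i, rfl⟩
    · simpa [coweightWord] using R.posCorootComb_zero
    · rw [List.concat_eq_append, coweightWord_append]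
      change R.PosCorootComb (g - R.coweightWord l (R.coweightRefl (R.simple i) g))
      by_cases h : R.weightWord l (R.simple i) ∈ R.posRoots
      · have := (ih l.length (by simp) l rfl).add (posCorootComb_smul_coroot h (hg i))
        convert this using 1
        rw [coweightRefl, coweightWord_sub_smul, hnd.coroot_weightWord l (R.simple_mem i)]
        abel
      · obtain ⟨l', hlen, hl'⟩ := hnd.exists_word_length_le hω l i h
        rw [hl']
        exact ih l'.length (by simpa using Nat.lt_succ_of_le hlen) l' rfl

/-- Every positive root is conjugate to a simple root. -/
lemma FormNondegenerate.exists_eq_weightWord_simple (hnd : R.FormNondegenerate)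
    (hω : ∀ i j, pair (R.coroot (R.simple j)) (ω i) = if i = j then 1 else 0)
    {β : Lat n} (hβ : β ∈ R.posRoots) : ∃ l i, β = R.weightWord l (R.simple i) := by
  induction hk : (pair (R.coroot β) (∑ i, ω i)).toNat using Nat.strong_induction_on
    generalizing β with
  | _ k ih =>
    subst hk
    obtain ⟨hr, b, hb⟩ := R.mem_posRoots.1 hβ
    obtain ⟨i, hi⟩ : ∃ i, 0 < pair (R.coroot β) (R.simple i) := by
      by_contra! hall
      have h2 := R.pair_coroot_self β hr
      nth_rewrite 2 [hb] at h2
      rw [pair_sum_right] at h2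
      have : ∑ i, pair (R.coroot β) ((b i : ℤ) • R.simple i) ≤ 0 := by
        refine Finset.sum_nonpos fun i _ => ?_
        rw [pair_smul_right]
        exact mul_nonpos_of_nonneg_of_nonpos (Int.natCast_nonneg _) (hall i)
      omega
    by_cases h : R.weightRefl (R.simple i) β ∈ R.posRoots
    · have hpos := hnd.pair_coroot_sum_fundamental_pos hω hβ
      have hlt : pair (R.coroot (R.weightRefl (R.simple i) β)) (∑ i, ω i) <
          pair (R.coroot β) (∑ i, ω i) := by
        rw [hnd.coroot_weightRefl (R.simple_mem i) hr, coweightRefl, pair_sub_left,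
          pair_smul_left]
        have := mul_pos hi (hnd.pair_coroot_sum_fundamental_pos hω (R.simple_mem_posRoots i))
        omega
      obtain ⟨l, j, hl⟩ := ih _ (by omega) h rfl
      refine ⟨i :: l, j, ?_⟩
      rw [weightWord_cons, ← hl, R.weightRefl_weightRefl (R.simple_mem i)]
    · exact ⟨[], i, hnd.eq_simple_of_weightRefl_notMem hω hβ h⟩

/-- Reflecting a coweight of the orbit of a dominant `g` part of the way along a root string
gives coweights strictly below `g`. -/
lemma FormNondegenerate.exists_posCorootComb_add_coroot (hnd : R.FormNondegenerate)
    (hω : ∀ i j, pair (R.coroot (R.simple j)) (ω i) = if i = j then 1 else 0)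
    {g : Lat n} (hg : R.IsDominant g) {l₀ : List (Fin m)} {i : Fin m}
    (h : 2 ≤ pair (R.coweightWord l₀ g) (R.simple i)) (l : List (Fin m)) :
    ∃ u, ∃ β ∈ R.posRoots, ∃ k : ℤ, 0 < k ∧ R.PosCorootComb u ∧
      g - R.coweightWord l (R.coweightWord l₀ g - R.coroot (R.simple i)) =
        u + k • R.coroot β := by
  set v := R.coweightWord l₀ g with hv
  have hlv : R.coweightWord l (v - R.coroot (R.simple i)) =
      R.coweightWord l v - R.coroot (R.weightWord l (R.simple i)) := by
    simpa [hnd.coroot_weightWord l (R.simple_mem i)] using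
      R.coweightWord_sub_smul l v (R.coroot (R.simple i)) 1
  by_cases hpos : R.weightWord l (R.simple i) ∈ R.posRoots
  · refine ⟨g - R.coweightWord l v, _, hpos, 1, one_pos, ?_, ?_⟩
    · rw [hv, ← coweightWord_append]
      exact hnd.posCorootComb_sub_coweightWord hω hg _
    · rw [hlv]; module
  · have hr := R.weightWord_mem l (R.simple_mem i)
    refine ⟨g - R.coweightWord (l ++ [i] ++ l₀) g, _, R.neg_mem_posRoots_of_notMem hr hpos,
      pair v (R.simple i) - 1, by omega, hnd.posCorootComb_sub_coweightWord hω hg _, ?_⟩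
    have hs : R.coweightWord (l ++ [i] ++ l₀) g = R.coweightWord l v -
        pair v (R.simple i) • R.coroot (R.weightWord l (R.simple i)) := by
      rw [coweightWord_append, coweightWord_append, ← hv, hnd.coroot_weightWord l (R.simple_mem i),
        ← coweightWord_sub_smul]
      rfl
    rw [hlv, hs, R.coroot_neg _ hr]
    module

lemma FormNondegenerate.pair_coweightWord_simple_le_one (hnd : R.FormNondegenerate)
    (hω : ∀ i j, pair (R.coroot (R.simple j)) (ω i) = if i = j then 1 else 0)
    {g : Lat n} (hg : R.Minuscule g) (hgc : g ∉ R.corootSpan) (l₀ : List (Fin m))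
    (i : Fin m) : pair (R.coweightWord l₀ g) (R.simple i) ≤ 1 := by
  obtain ⟨hdom, -, hmin⟩ := hg
  by_contra! hlt
  have hbelow := hnd.exists_posCorootComb_add_coroot hω hdom (l₀ := l₀) (i := i) hlt
  set x := R.coweightWord l₀ g - R.coroot (R.simple i) with hx
  have hΩ : ∀ l, pair (R.coweightWord l x) (∑ i, ω i) < pair g (∑ i, ω i) := by
    intro l
    obtain ⟨u, β, hβ, k, hk, hu, heq⟩ := hbelow l
    have h1 := congrArg (fun v => pair v (∑ i, ω i)) heq
    simp only [pair_sub_left, pair_add_left, pair_smul_left] at h1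
    have h2 := hu.pair_nonneg fun β hβ => (hnd.pair_coroot_sum_fundamental_pos hω hβ).le
    have h3 := mul_pos hk (hnd.pair_coroot_sum_fundamental_pos hω hβ)
    linarith
  obtain ⟨_, ⟨l, rfl⟩, hmax⟩ := Int.exists_greatest_of_bdd
    (P := fun z => ∃ l, pair (R.coweightWord l x) (∑ i, ω i) = z)
    ⟨pair g (∑ i, ω i), fun z ⟨l, hl⟩ => hl ▸ (hΩ l).le⟩ ⟨_, [], rfl⟩
  have hxdom : R.IsDominant (R.coweightWord l x) := by
    intro j
    have h := hmax _ ⟨j :: l, rfl⟩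
    rw [coweightWord_cons, coweightRefl, pair_sub_left, pair_smul_left] at h
    exact nonneg_of_mul_nonneg_left (by linarith)
      (hnd.pair_coroot_sum_fundamental_pos hω (R.simple_mem_posRoots j))
  have hx0 : R.coweightWord l x ≠ 0 := by
    intro h0
    have hx0 : x = 0 := by
      rw [← R.coweightWord_reverse l x, h0, coweightWord_zero]
    refine hgc ?_
    have h1 := (hnd.posCorootComb_sub_coweightWord hω hdom l₀).mem_corootSpan
    have h2 := add_mem h1 (R.coroot_mem_corootSpan (R.simple_mem i))
    rw [hx, sub_eq_zero] at hx0
    rwa [← hx0, sub_add_cancel] at h2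
  obtain ⟨u, β, hβ, k, hk, hu, heq⟩ := hbelow l
  have hle : R.cole (R.coweightWord l x) g := by
    rw [cole, heq]
    exact hu.add (posCorootComb_smul_coroot hβ hk.le)
  have := hΩ l
  rw [hmin _ hxdom hx0 hle] at this
  exact lt_irrefl _ this

lemma FormNondegenerate.pair_posRoot_le_one (hnd : R.FormNondegenerate)
    (hω : ∀ i j, pair (R.coroot (R.simple j)) (ω i) = if i = j then 1 else 0)
    {g : Lat n} (hg : R.Minuscule g) (hgc : g ∉ R.corootSpan) {α : Lat n}
    (hα : α ∈ R.posRoots) : pair g α ≤ 1 := by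
  obtain ⟨l, i, rfl⟩ := hnd.exists_eq_weightWord_simple hω hα
  have h := R.pair_coweightWord_weightWord l (R.coweightWord l.reverse g) (R.simple i)
  have h' := R.coweightWord_reverse l.reverse g
  rw [List.reverse_reverse] at h'
  rw [h'] at h
  rw [h]
  exact hnd.pair_coweightWord_simple_le_one hω hg hgc _ i

lemma FormNondegenerate.pair_coroot_simple_nonpos (hnd : R.FormNondegenerate)
    (hω : ∀ i j, pair (R.coroot (R.simple j)) (ω i) = if i = j then 1 else 0)
    {j k : Fin m} (hjk : k ≠ j) : pair (R.coroot (R.simple j)) (R.simple k) ≤ 0 := by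
  by_cases h : R.weightRefl (R.simple j) (R.simple k) ∈ R.posRoots
  · obtain ⟨-, c, hc⟩ := R.mem_posRoots.1 h
    have hsum : ∑ i, ((c i : ℤ) + (if i = j then pair (R.coroot (R.simple j)) (R.simple k)
        else 0) - if i = k then 1 else 0) • R.simple i = 0 := by
      simp only [sub_smul, add_smul, Finset.sum_sub_distrib, Finset.sum_add_distrib, ite_smul,
        zero_smul, one_smul, Finset.sum_ite_eq', Finset.mem_univ, if_true]
      rw [← hc, weightRefl]
      module
    have := hnd.simple_coeff_eq_zero hω hsum j
    rw [if_pos rfl, if_neg hjk.symm] at this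
    omega
  · exact absurd (R.simple_inj
      (hnd.eq_simple_of_weightRefl_notMem hω (R.simple_mem_posRoots k) h)) hjk

lemma pair_coroot_nonneg_of_maximal {α : Lat n} (hα : α ∈ R.posRoots)
    (hmax : ∀ β ∈ R.posRoots,
      (∃ c : Fin m → ℕ, β - α = ∑ i, (c i : ℤ) • R.simple i) → β = α) (j : Fin m) :
    0 ≤ pair (R.coroot (R.simple j)) α := by
  by_contra! hlt
  obtain ⟨hr, b, hb⟩ := R.mem_posRoots.1 hα
  obtain ⟨k, hk⟩ := Int.eq_ofNat_of_zero_le (neg_nonneg.2 hlt.le)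
  have hrefl : R.weightRefl (R.simple j) α = α + (k : ℤ) • R.simple j := by
    rw [weightRefl, ← hk]; module
  have hsum : (k : ℤ) • R.simple j =
      ∑ i, ((Pi.single j k : Fin m → ℕ) i : ℤ) • R.simple i := by
    rw [Finset.sum_eq_single j]
    · simp
    · exact fun i _ hi => by simp [hi]
    · exact fun h => absurd (Finset.mem_univ j) h
  have hmem : R.weightRefl (R.simple j) α ∈ R.posRoots := by
    refine R.mem_posRoots.2 ⟨R.reflect_mem _ (R.simple_mem j) α hr, b + Pi.single j k, ?_⟩
    rw [hrefl, hsum]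
    conv_lhs => rw [hb]
    simp only [Pi.add_apply, Nat.cast_add, add_smul, Finset.sum_add_distrib]
  have heq := hmax _ hmem ⟨Pi.single j k, by rw [hrefl, add_sub_cancel_left, hsum]⟩
  rw [hrefl, add_eq_left, smul_eq_zero] at heq
  rcases heq with h0 | h0
  · omega
  · exact R.root_ne_zero _ (R.simple_mem j) h0

/-- If a dominant coweight is orthogonal to a maximal root, then some simple root is orthogonal
to its whole Weyl orbit. -/
lemma FormNondegenerate.exists_simple_orthogonal_orbit (hnd : R.FormNondegenerate)
    (hω : ∀ i j, pair (R.coroot (R.simple j)) (ω i) = if i = j then 1 else 0)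
    {g : Lat n} (hg : R.IsDominant g) {α : Lat n} (hα : α ∈ R.posRoots)
    (hmax : ∀ β ∈ R.posRoots,
      (∃ c : Fin m → ℕ, β - α = ∑ i, (c i : ℤ) • R.simple i) → β = α)
    (h0 : pair g α = 0) : ∃ k, ∀ l, pair (R.coweightWord l g) (R.simple k) = 0 := by
  obtain ⟨hr, b, hb⟩ := R.mem_posRoots.1 hα
  have hterm : ∀ k, (b k : ℤ) * pair g (R.simple k) = 0 := by
    rw [hb, pair_sum_right, Finset.sum_eq_zero_iff_of_nonneg fun k _ => by
      rw [pair_smul_right]; exact mul_nonneg (Int.natCast_nonneg _) (hg k)] at h0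
    intro k
    rw [← pair_smul_right]
    exact h0 k (Finset.mem_univ k)
  have horth : ∀ j, b j = 0 → ∀ k, b k ≠ 0 → pair (R.coroot (R.simple j)) (R.simple k) = 0 := by
    intro j hj k hk
    have hnp : ∀ i ∈ Finset.univ,
        pair (R.coroot (R.simple j)) ((b i : ℤ) • R.simple i) ≤ 0 := by
      intro i _
      rw [pair_smul_right]
      by_cases hij : i = j
      · rw [hij, hj, Nat.cast_zero, zero_mul]
      · exact mul_nonpos_of_nonneg_of_nonpos (Int.natCast_nonneg _)
          (hnd.pair_coroot_simple_nonpos hω hij)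
    have hs : ∑ i, pair (R.coroot (R.simple j)) ((b i : ℤ) • R.simple i) = 0 := by
      refine le_antisymm (Finset.sum_nonpos hnp) ?_
      rw [← pair_sum_right, ← hb]
      exact pair_coroot_nonneg_of_maximal hα hmax j
    have := (Finset.sum_eq_zero_iff_of_nonpos hnp).1 hs k (Finset.mem_univ k)
    rw [pair_smul_right, mul_eq_zero] at this
    exact this.resolve_left (by exact_mod_cast hk)
  have hall : ∀ l, ∀ k, b k ≠ 0 → pair (R.coweightWord l g) (R.simple k) = 0 := by
    intro l
    induction l with
    | nil => exact fun k hk => (mul_eq_zero.1 (hterm k)).resolve_left (by exact_mod_cast hk)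
    | cons j l ih =>
      intro k hk
      rw [coweightWord_cons, coweightRefl, pair_sub_left, pair_smul_left, ih k hk]
      by_cases hj : b j = 0
      · rw [horth j hj k hk]; ring
      · rw [ih j hj]; ring
  obtain ⟨k, hk⟩ : ∃ k, b k ≠ 0 := by
    by_contra! hb0
    exact R.root_ne_zero α hr (by rw [hb]; simp [hb0])
  exact ⟨k, fun l => hall l k hk⟩

end Nondegenerate

lemma notMem_corootSpan_of_generates {g : Lat n} (hp : Nonempty (R.Pi1 ≃ₗ[ℤ] ℤ))
    (hgen : ∀ x : R.Pi1, ∃ k : ℤ, x = k • R.toPi1 g) : g ∉ R.corootSpan := by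
  intro hmem
  obtain ⟨e⟩ := hp
  obtain ⟨k, hk⟩ := hgen (e.symm 1)
  have h0 : R.toPi1 g = 0 := (Submodule.Quotient.mk_eq_zero _).2 hmem
  rw [h0, smul_zero, LinearEquiv.symm_apply_eq, map_zero] at hk
  exact one_ne_zero hk

end RootDatum

/-- For a 1-admissible datum `γ`: the weights of `V^γ` (the Weyl
orbit of `γ`) generate the coweight lattice `Λ`; `⟨γ, ω̌ᵢ⟩ > 0` for every
(normalized) fundamental weight `ω̌ᵢ`; and `⟨γ, α̌⟩ = 1` for every maximal positive
root `α̌`. -/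
theorem one_admissible_pairings
    {n m : ℕ} (R : RootDatum n m) (γ : Lat n)
    (hγ : R.IsOneAdmissible γ)
    (w0 : Equiv.Perm (Lat n)) (hw0 : w0 ∈ R.weyl)
    (hw0d : ∀ v : Lat n, R.IsDominant v → R.IsDominant (-(w0 v)))
    (ω : Fin m → Lat n)
    (hω : ∀ i j, pair (R.coroot (R.simple j)) (ω i) = if i = j then 1 else 0)
    (hωw0 : ∀ i, pair (w0 γ) (ω i) = 0) :
    Submodule.span ℤ (R.orbit γ) = ⊤ ∧
    (∀ i, 0 < pair γ (ω i)) ∧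
    (∀ α ∈ R.posRoots,
      (∀ β ∈ R.posRoots,
        (∃ c : Fin m → ℕ, β - α = ∑ i, (c i : ℤ) • R.simple i) → β = α) →
      pair γ α = 1) := by
  obtain ⟨hc, hp, hmin, hgen, hspan⟩ := hγ
  have hnd := R.formNondegenerate hc hp
  refine ⟨hspan, fun i => ?_, fun α hα hmax => le_antisymm ?_ ?_⟩
  · by_contra! hle
    have hzero : ∀ v ∈ R.orbit γ, pair v (ω i) = 0 := by
      rintro _ ⟨w, hw, rfl⟩
      obtain ⟨l, hl⟩ := R.exists_coweightWord_eq hw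
      obtain ⟨l', hl'⟩ := R.exists_coweightWord_eq (R.weyl.mul_mem hw (R.weyl.inv_mem hw0))
      have hnn := fun β (hβ : β ∈ R.posRoots) =>
        hnd.pair_coroot_fundamental_nonneg hω hβ i
      have h1 := (hnd.posCorootComb_sub_coweightWord hω hmin.1 l).pair_nonneg hnn
      have h2 := (hnd.posCorootComb_sub_coweightWord hω (hw0d γ hmin.1) l').pair_nonneg hnn
      have inv_w0 : w0⁻¹ (w0 γ) = γ := w0.symm_apply_apply γ
      rw [R.coweightWord_neg, ← hl', Equiv.Perm.mul_apply, inv_w0,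
        pair_sub_left, pair_neg_left, pair_neg_left, hωw0] at h2
      rw [← hl, pair_sub_left] at h1
      linarith
    have h := pair_eq_zero_of_mem_span hzero
      (hspan.symm ▸ Submodule.mem_top : R.coroot (R.simple i) ∈ _)
    rw [hω, if_pos rfl] at h
    exact one_ne_zero h
  · exact hnd.pair_posRoot_le_one hω hmin (R.notMem_corootSpan_of_generates hp hgen) hα
  · obtain ⟨-, b, hb⟩ := R.mem_posRoots.1 hα
    have hnn : 0 ≤ pair γ α := by
      rw [hb, pair_sum_right]
      refine Finset.sum_nonneg fun k _ => ?_
      rw [pair_smul_right]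
      exact mul_nonneg (Int.natCast_nonneg _) (hmin.1 k)
    refine lt_of_le_of_ne hnn fun h0 => ?_
    obtain ⟨k, hk⟩ := hnd.exists_simple_orthogonal_orbit hω hmin.1 hα hmax h0.symm
    have hzero : ∀ v ∈ R.orbit γ, pair v (R.simple k) = 0 := by
      rintro _ ⟨w, hw, rfl⟩
      obtain ⟨l, hl⟩ := R.exists_coweightWord_eq hw
      rw [hl, hk]
    have h := pair_eq_zero_of_mem_span hzero
      (hspan.symm ▸ Submodule.mem_top : R.coroot (R.simple k) ∈ _)
    rw [R.pair_coroot_self _ (R.simple_mem k)] at h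
    exact two_ne_zero h

end AutSheaf
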